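/- arXiv:2408.12642 — 4 statements merged into one kernel-verified Lean document; each statement's English description precedes it below -/
import Mathlib

section
/- Let T be a tempered distribution on ℝ with compact support, i.e., there is R > 0 such that T(φ) = 0 for every Schwartz function φ whose support is disjoint from [−R, R]. Then there exists an entire function G : ℂ → ℂ such that the Fourier transform of T is represented by the restriction of G to ℝ, i.e., T(φ̂) = ∫_ℝ G(ω) φ(ω) dω for every Schwartz function φ. -/
open MeasureTheory

/-- The Fourier transform of a Schwartz function, with the convention
`φ̂(ω) = ∫ φ(t) e^{−iωt} dt`. -/
noncomputable def fourierHat (φ : SchwartzMap ℝ ℂ) (ω : ℝ) : ℂ :=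
  ∫ t : ℝ, φ t * Complex.exp (-(Complex.I * (ω : ℂ) * (t : ℂ)))

open scoped FourierTransform

/-- The restrictions to `K` of the derivatives of order at most `N` of a Schwartz function. -/
noncomputable def jetRestrict (K : Set ℝ) (N : ℕ) :
    SchwartzMap ℝ ℂ →ₗ[ℂ] (Fin (N + 1) → C(K, ℂ)) where
  toFun f l := ⟨fun t => iteratedDeriv l f t,
    ((f.smooth l).continuous_iteratedDeriv l le_rfl).comp continuous_subtype_val⟩
  map_add' f g := by
    ext l t
    simp only [ContinuousMap.coe_mk, Pi.add_apply, ContinuousMap.add_apply]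
    exact iteratedDeriv_add (f.smooth l).contDiffAt (g.smooth l).contDiffAt
  map_smul' c f := by
    ext l t
    simp only [ContinuousMap.coe_mk, Pi.smul_apply, ContinuousMap.smul_apply, RingHom.id_apply]
    exact iteratedDeriv_const_smul (f.smooth l).contDiffAt c

lemma norm_iteratedFDeriv_le_norm_jetRestrict {K : Set ℝ} [CompactSpace K] {N n : ℕ} (hn : n ≤ N)
    (f : SchwartzMap ℝ ℂ) {x : ℝ} (hx : x ∈ K) :
    ‖iteratedFDeriv ℝ n f x‖ ≤ ‖jetRestrict K N f‖ := by
  rw [norm_iteratedFDeriv_eq_norm_iteratedDeriv]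
  exact (ContinuousMap.norm_coe_le_norm (jetRestrict K N f ⟨n, by lia⟩) ⟨x, hx⟩).trans
    (norm_le_pi_norm _ _)

lemma exists_seminorm_smulLeftCLM_le_jetRestrict {K : Set ℝ} [CompactSpace K]
    (χ : SchwartzMap ℝ ℂ) (hχ : tsupport χ ⊆ K) {N n : ℕ} (k : ℕ) (hn : n ≤ N) :
    ∃ C : ℝ, 0 ≤ C ∧ ∀ f, SchwartzMap.seminorm ℂ k n (SchwartzMap.smulLeftCLM ℂ χ f) ≤
      C * ‖jetRestrict K N f‖ := by
  refine ⟨∑ i ∈ Finset.range (n + 1), n.choose i * SchwartzMap.seminorm ℂ k i χ,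
    by positivity, fun f => ?_⟩
  refine SchwartzMap.seminorm_le_bound ℂ k n _ (by positivity) fun x => ?_
  have hcoe : (SchwartzMap.smulLeftCLM ℂ χ f : ℝ → ℂ) = fun y => χ y * f y := by
    ext y
    rw [SchwartzMap.smulLeftCLM_apply_apply χ.hasTemperateGrowth, smul_eq_mul]
  by_cases hx : x ∈ K
  · rw [hcoe]
    calc
      _ ≤ ‖x‖ ^ k * ∑ i ∈ Finset.range (n + 1), (n.choose i : ℝ) *
          ‖iteratedFDeriv ℝ i χ x‖ * ‖iteratedFDeriv ℝ (n - i) f x‖ := by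
        gcongr
        exact norm_iteratedFDeriv_mul_le (χ.smooth n) (f.smooth n) x le_rfl
      _ = ∑ i ∈ Finset.range (n + 1), n.choose i *
          (‖x‖ ^ k * ‖iteratedFDeriv ℝ i χ x‖) * ‖iteratedFDeriv ℝ (n - i) f x‖ := by
        rw [Finset.mul_sum]
        exact Finset.sum_congr rfl fun i _ => by ring
      _ ≤ ∑ i ∈ Finset.range (n + 1), n.choose i *
          SchwartzMap.seminorm ℂ k i χ * ‖jetRestrict K N f‖ := by
        gcongr with i hi
        · exact χ.le_seminorm ℂ k i x
        · exact norm_iteratedFDeriv_le_norm_jetRestrict (by lia) f hx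
      _ = _ := by rw [Finset.sum_mul]
  · have h0 : iteratedFDeriv ℝ n (SchwartzMap.smulLeftCLM ℂ χ f) x = 0 := by
      by_contra h
      refine hx (hχ ?_)
      exact (SchwartzMap.tsupport_smulLeftCLM_subset χ f
        (support_iteratedFDeriv_subset n h)).2
    rw [h0, norm_zero, mul_zero]
    positivity

lemma LinearMap.exists_strongDual_comp_eq {𝕜 V E : Type*} [RCLike 𝕜] [AddCommGroup V] [Module 𝕜 V]
    [NormedAddCommGroup E] [NormedSpace 𝕜 E] (J : V →ₗ[𝕜] E) (S : V →ₗ[𝕜] 𝕜) (C : ℝ)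
    (h : ∀ v, ‖S v‖ ≤ C * ‖J v‖) : ∃ L : StrongDual 𝕜 E, ∀ v, L (J v) = S v := by
  have hker : J.ker ≤ S.ker := fun v hv => by
    have := h v
    rw [LinearMap.mem_ker.1 hv, norm_zero, mul_zero] at this
    exact norm_le_zero_iff.1 this
  let g : J.range →ₗ[𝕜] 𝕜 := J.ker.liftQ S hker ∘ₗ J.quotKerEquivRange.symm
  have hg (v : V) : g ⟨J v, v, rfl⟩ = S v := by
    have : J.quotKerEquivRange.symm ⟨J v, v, rfl⟩ = J.ker.mkQ v := by
      rw [LinearEquiv.symm_apply_eq]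
      rfl
    simp only [g, LinearMap.comp_apply, LinearEquiv.coe_coe, this]
    rfl
  obtain ⟨L, hL, -⟩ := exists_extension_norm_eq J.range (g.mkContinuous C (by
    rintro ⟨_, v, rfl⟩
    rw [hg]
    exact h v))
  refine ⟨L, fun v => ?_⟩
  rw [← hg v]
  exact hL ⟨J v, v, rfl⟩

lemma exists_strongDual_jetRestrict {K : Set ℝ} [CompactSpace K] (T : SchwartzMap ℝ ℂ →L[ℂ] ℂ)
    (χ : SchwartzMap ℝ ℂ) (hχ : tsupport χ ⊆ K) :
    ∃ (N : ℕ) (L : StrongDual ℂ (Fin (N + 1) → C(K, ℂ))),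
      ∀ f, L (jetRestrict K N f) = T (SchwartzMap.smulLeftCLM ℂ χ f) := by
  obtain ⟨s, C, -, hT⟩ := Seminorm.bound_of_continuous (schwartz_withSeminorms ℂ ℝ ℂ)
    ((normSeminorm ℂ ℂ).comp T.toLinearMap) (continuous_norm.comp T.continuous)
  have hs (i : ℕ × ℕ) (hi : i ∈ s) : i.2 ≤ s.sup Prod.snd := Finset.le_sup (f := Prod.snd) hi
  choose! D hD0 hD using fun (i : ℕ × ℕ) (hi : i ∈ s) =>
    exists_seminorm_smulLeftCLM_le_jetRestrict χ hχ i.1 (hs i hi)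
  refine ⟨s.sup Prod.snd, LinearMap.exists_strongDual_comp_eq _
    (T.toLinearMap ∘ₗ (SchwartzMap.smulLeftCLM ℂ χ).toLinearMap) (C * ∑ i ∈ s, D i) fun f => ?_⟩
  refine (hT (SchwartzMap.smulLeftCLM ℂ χ f)).trans ?_
  rw [smul_apply, NNReal.smul_def, smul_eq_mul, mul_assoc]
  gcongr
  refine Seminorm.finset_sup_apply_le
    (mul_nonneg (Finset.sum_nonneg hD0) (norm_nonneg _)) fun i hi => (hD i hi f).trans ?_
  gcongr
  exact Finset.single_le_sum hD0 hi

/-- The function `t ↦ e^{-izt}` as an element of the Banach algebra `C(K, ℂ)`. -/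
noncomputable def expOn (K : Set ℝ) [CompactSpace K] (z : ℂ) : C(K, ℂ) :=
  ⟨fun t => Complex.exp (-(Complex.I * z * (t : ℝ))), by fun_prop⟩

lemma differentiable_expOn (K : Set ℝ) [CompactSpace K] : Differentiable ℂ (expOn K) := by
  let X : C(K, ℂ) := ⟨fun t => -(Complex.I * (t : ℝ)), by fun_prop⟩
  have h : expOn K = fun z : ℂ => NormedSpace.exp (z • X) := by
    ext z t
    have := NormedSpace.map_exp (ContinuousMap.evalAlgHom ℂ ℂ t)
      (continuous_eval_const t) (z • X)
    rw [← Complex.exp_eq_exp_ℂ] at this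
    refine Eq.trans ?_ this.symm
    simp only [expOn, X, ContinuousMap.coe_mk, ContinuousMap.evalAlgHom_apply,
      ContinuousMap.smul_apply, smul_eq_mul]
    congr 1
    ring
  rw [h]
  exact fun z => (hasDerivAt_exp_smul_const X z).differentiableAt

lemma norm_expOn_ofReal_le (K : Set ℝ) [CompactSpace K] (ω : ℝ) : ‖expOn K ω‖ ≤ 1 := by
  refine (ContinuousMap.norm_le _ zero_le_one).2 fun t => ?_
  simp [expOn, Complex.norm_exp]

/-- The derivatives of `t ↦ e^{-izt}` of order at most `N`, as continuous functions on `K`. -/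
noncomputable def expJet (K : Set ℝ) [CompactSpace K] (N : ℕ) (z : ℂ) : Fin (N + 1) → C(K, ℂ) :=
  fun l => (-(Complex.I * z)) ^ (l : ℕ) • expOn K z

lemma differentiable_expJet (K : Set ℝ) [CompactSpace K] (N : ℕ) :
    Differentiable ℂ (expJet K N) := by
  refine differentiable_pi.2 fun l => ?_
  have hpow : Differentiable ℂ fun z : ℂ => (-(Complex.I * z)) ^ (l : ℕ) := by fun_prop
  exact hpow.smul (differentiable_expOn K)

lemma integrable_smul_expJet (K : Set ℝ) [CompactSpace K] (N : ℕ) (φ : SchwartzMap ℝ ℂ) :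
    Integrable fun ω : ℝ => φ ω • expJet K N ω := by
  have hcont : Continuous fun ω : ℝ => φ ω • expJet K N ω :=
    φ.continuous.smul ((differentiable_expJet K N).continuous.comp Complex.continuous_ofReal)
  refine Integrable.mono' (g := fun ω => ∑ l : Fin (N + 1), ‖ω‖ ^ (l : ℕ) * ‖φ ω‖)
    (integrable_finsetSum _ fun l _ => φ.integrable_pow_mul volume l)
    hcont.aestronglyMeasurable (.of_forall fun ω => ?_)
  refine (pi_norm_le_iff_of_nonneg (by positivity)).2 fun l => ?_
  calc
    _ = ‖ω‖ ^ (l : ℕ) * ‖φ ω‖ * ‖expOn K ω‖ := by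
      simp [expJet, norm_smul]; ring
    _ ≤ ‖ω‖ ^ (l : ℕ) * ‖φ ω‖ := mul_le_of_le_one_right (by positivity) (norm_expOn_ofReal_le K ω)
    _ ≤ _ := Finset.single_le_sum (f := fun l : Fin (N + 1) => ‖ω‖ ^ (l : ℕ) * ‖φ ω‖)
      (fun _ _ => by positivity) (Finset.mem_univ l)

lemma iteratedDeriv_fourierHat (φ : SchwartzMap ℝ ℂ) (n : ℕ) (t : ℝ) :
    iteratedDeriv n (fourierHat φ) t =
      ∫ ω : ℝ, φ ω * ((-(Complex.I * ω)) ^ n * Complex.exp (-(Complex.I * ω * t))) := by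
  have hscale : fourierHat φ = fun t => 𝓕 (φ : ℝ → ℂ) ((2 * Real.pi)⁻¹ * t) := by
    ext t
    rw [Real.fourier_real_eq_integral_exp_smul, fourierHat]
    refine integral_congr_ae (.of_forall fun ω => ?_)
    simp only [smul_eq_mul]
    rw [mul_comm]
    congr 2
    have : (Real.pi : ℂ) ≠ 0 := by exact_mod_cast Real.pi_ne_zero
    push_cast
    field_simp
  have hsmooth : ContDiff ℝ n (𝓕 (φ : ℝ → ℂ)) := by
    rw [← SchwartzMap.fourier_coe]
    exact (𝓕 φ).smooth n
  have hint (m : ℕ) (_ : (m : ℕ∞) ≤ n) : Integrable fun x : ℝ => x ^ m • φ x := by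
    refine (integrable_norm_iff (by fun_prop)).1 ?_
    simpa [norm_smul] using φ.integrable_pow_mul volume m
  rw [hscale]
  rw [iteratedDeriv_comp_const_smul hsmooth (2 * Real.pi)⁻¹, Real.iteratedDeriv_fourier (N := n) hint le_rfl]
  dsimp only
  rw [Real.fourier_real_eq_integral_exp_smul, ← integral_smul]
  refine integral_congr_ae (.of_forall fun ω => ?_)
  have hpi : (Real.pi : ℂ) ≠ 0 := by exact_mod_cast Real.pi_ne_zero
  have h1 : (((-2 * Real.pi * ω * ((2 * Real.pi)⁻¹ * t) : ℝ) : ℂ)) * Complex.I =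
      -(Complex.I * ω * t) := by
    push_cast
    field_simp
  have h2 : -(Complex.I * (ω : ℂ)) = (2 * Real.pi : ℂ)⁻¹ * (-2 * Real.pi * Complex.I * ω) := by
    field_simp
  simp only [h1, h2, mul_pow, Complex.real_smul, smul_eq_mul]
  push_cast
  ring

lemma jetRestrict_eq_integral (K : Set ℝ) [CompactSpace K] (N : ℕ) {φ ψ : SchwartzMap ℝ ℂ}
    (h : ∀ ω : ℝ, ψ ω = fourierHat φ ω) :
    jetRestrict K N ψ = ∫ ω : ℝ, φ ω • expJet K N ω := by
  ext l t
  let ev : (Fin (N + 1) → C(K, ℂ)) →L[ℂ] ℂ :=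
    (ContinuousMap.evalCLM ℂ t).comp (ContinuousLinearMap.proj l)
  refine Eq.trans ?_ (ev.integral_comp_comm (integrable_smul_expJet K N φ))
  have hψ : (ψ : ℝ → ℂ) = fourierHat φ := funext h
  change iteratedDeriv l ψ t = _
  rw [hψ, iteratedDeriv_fourierHat]
  rfl

lemma exists_schwartzMap_eq_one_on_Icc {R : ℝ} (hR : 0 < R) :
    ∃ χ : SchwartzMap ℝ ℂ, tsupport χ ⊆ Set.Icc (-(R + 2)) (R + 2) ∧
      ∀ x ∈ Set.Icc (-(R + 1)) (R + 1), χ x = 1 := by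
  let b : ContDiffBump (0 : ℝ) := ⟨R + 1, R + 2, by linarith, by linarith⟩
  have hsub : tsupport (fun x => (b x : ℂ)) ⊆ tsupport b :=
    closure_mono fun x hx hb => hx (by simp [hb])
  have hcs : HasCompactSupport fun x => (b x : ℂ) :=
    b.hasCompactSupport.of_isClosed_subset (isClosed_tsupport _) hsub
  refine ⟨hcs.toSchwartzMap (Complex.ofRealCLM.contDiff.comp b.contDiff), ?_, fun x hx => ?_⟩
  · refine hsub.trans ?_
    rw [b.tsupport_eq, Real.closedBall_eq_Icc]
    simp [b]
  · have : b x = 1 := b.one_of_mem_closedBall (by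
      rw [Real.closedBall_eq_Icc]
      simpa [b] using hx)
    change (b x : ℂ) = 1
    rw [this, Complex.ofReal_one]

lemma apply_smulLeftCLM_eq_of_eq_one {T : SchwartzMap ℝ ℂ →L[ℂ] ℂ} {R : ℝ}
    (hsupp : ∀ φ : SchwartzMap ℝ ℂ, Disjoint (tsupport φ) (Set.Icc (-R) R) → T φ = 0)
    {χ : SchwartzMap ℝ ℂ} (hχ : ∀ x ∈ Set.Icc (-(R + 1)) (R + 1), χ x = 1)
    (ψ : SchwartzMap ℝ ℂ) : T (SchwartzMap.smulLeftCLM ℂ χ ψ) = T ψ := by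
  rw [← sub_eq_zero, ← map_sub]
  refine hsupp _ (Set.disjoint_left.2 fun x hx hxR => ?_)
  refine (notMem_tsupport_iff_eventuallyEq.2 ?_) hx
  filter_upwards [Icc_mem_nhds (show -(R + 1) < x by linarith [hxR.1])
    (show x < R + 1 by linarith [hxR.2])] with y hy
  simp [SchwartzMap.smulLeftCLM_apply_apply χ.hasTemperateGrowth, hχ y hy]

/-- Schwartz–Paley–Wiener: the Fourier transform of a compactly supported tempered
distribution on `ℝ` is represented by (the restriction to `ℝ` of) an entire function
`G : ℂ → ℂ`, i.e. `T(φ̂) = ∫ G(ω) φ(ω) dω` for every Schwartz `φ` (where `ψ` stands for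
the Schwartz function `φ̂`). -/
theorem schwartz_paley_wiener (T : SchwartzMap ℝ ℂ →L[ℂ] ℂ)
    (R : ℝ) (hR : 0 < R)
    (hsupp : ∀ φ : SchwartzMap ℝ ℂ, Disjoint (tsupport φ) (Set.Icc (-R) R) → T φ = 0) :
    ∃ G : ℂ → ℂ, Differentiable ℂ G ∧
      ∀ φ ψ : SchwartzMap ℝ ℂ, (∀ ω : ℝ, ψ ω = fourierHat φ ω) →
        T ψ = ∫ ω : ℝ, G (ω : ℂ) * φ ω := by
  obtain ⟨χ, hχK, hχ1⟩ := exists_schwartzMap_eq_one_on_Icc hR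
  obtain ⟨N, L, hL⟩ := exists_strongDual_jetRestrict T χ hχK
  refine ⟨fun z => L (expJet _ N z), L.differentiable.comp (differentiable_expJet _ N),
    fun φ ψ h => ?_⟩
  rw [← apply_smulLeftCLM_eq_of_eq_one hsupp hχ1, ← hL, jetRestrict_eq_integral _ N h,
    ← L.integral_comp_comm (integrable_smul_expJet _ N φ)]
  simp [mul_comm]
end

section
/- Let ρ : ℝ → ℝ be continuous and odd (ρ(−ω) = −ρ(ω)) with ρ(ω) > 0 for all ω > 0, differentiable at 0 with ρ′(0) ≠ 0, and suppose there exist C > 0 and k ∈ ℕ such that ρ(ω) ≥ C (1 + ω)^{−k} for all ω ≥ 1. Then for every t₀ ∈ ℝ there exists a smooth, compactly supported, not identically zero function ψ : ℝ → ℂ with support contained in (−∞, t₀], satisfying ψ̂(−ω) = −conj(ψ̂(ω)) for all ω ∈ ℝ, and ∫₀^∞ |ψ̂(ω)|² / ρ(ω) dω < ∞, where ψ̂(ω) = ∫_ℝ ψ(t) e^{−iωt} dt. -/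
open MeasureTheory
open scoped FourierTransform

/-- The Fourier integral in the angular-frequency convention, through Mathlib's `𝓕`. -/
lemma integral_mul_exp_eq_fourier (f : ℝ → ℂ) (ω : ℝ) :
    ∫ t : ℝ, f t * Complex.exp (-(Complex.I * (ω : ℂ) * (t : ℂ))) = 𝓕 f (ω / (2 * Real.pi)) := by
  rw [Real.fourier_eq']
  congr 1 with t
  rw [smul_eq_mul, mul_comm]
  congr 2
  have : (Real.pi : ℂ) ≠ 0 := by exact_mod_cast Real.pi_ne_zero
  simp
  field_simp

/-- A continuous function positive on `(0, ∞)` with a nonzero derivative at its zero `0` dominates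
a positive multiple of the identity on `[0, 1]`. -/
lemma exists_mul_le_of_hasDerivAt_zero {ρ : ℝ → ℝ} (hcont : Continuous ρ) (h0 : ρ 0 = 0)
    (hpos : ∀ ω : ℝ, 0 < ω → 0 < ρ ω) {d : ℝ} (hd : HasDerivAt ρ d 0) (hd0 : d ≠ 0) :
    ∃ c > 0, ∀ ω ∈ Set.Icc (0 : ℝ) 1, c * ω ≤ ρ ω := by
  have hc : Continuous (dslope ρ 0) := by
    rw [← continuousOn_univ]
    exact (continuousOn_dslope Filter.univ_mem).2 ⟨hcont.continuousOn, hd.differentiableAt⟩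
  have hsl : ∀ ω : ℝ, 0 < ω → 0 < dslope ρ 0 ω := fun ω hω => by
    rw [dslope_of_ne _ hω.ne', slope_def_field, h0]
    simpa using div_pos (hpos ω hω) hω
  have h0' : 0 < dslope ρ 0 0 := by
    refine lt_of_le_of_ne ?_ (by rw [dslope_same, hd.deriv]; exact hd0.symm)
    refine ge_of_tendsto (hc.continuousAt.tendsto.mono_left nhdsWithin_le_nhds :
      Filter.Tendsto _ (nhdsWithin (0:ℝ) (Set.Ioi 0)) _) ?_
    filter_upwards [self_mem_nhdsWithin] with x hx using (hsl x hx).le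
  obtain ⟨x, hx, hmin⟩ := isCompact_Icc.exists_isMinOn (Set.nonempty_Icc.2 zero_le_one)
    (hc.continuousOn (s := Set.Icc (0:ℝ) 1))
  refine ⟨dslope ρ 0 x, ?_, fun ω hω => ?_⟩
  · rcases hx.1.eq_or_lt with h | h
    · exact h ▸ h0'
    · exact hsl x h
  · have h1 := hmin hω
    have h2 : ω * dslope ρ 0 ω = ρ ω := by simpa [h0] using sub_smul_dslope ρ 0 ω
    rw [← h2, mul_comm]
    exact mul_le_mul_of_nonneg_left h1 hω.1

/-- Complex conjugation symmetry of the Fourier integral of a purely imaginary function. -/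
lemma integral_I_mul_ofReal_exp_neg (f : ℝ → ℝ) (ω : ℝ) :
    ∫ t : ℝ, Complex.I * (f t : ℂ) * Complex.exp (-(Complex.I * ((-ω : ℝ) : ℂ) * (t : ℂ))) =
      -(starRingEnd ℂ)
        (∫ t : ℝ, Complex.I * (f t : ℂ) * Complex.exp (-(Complex.I * (ω : ℂ) * (t : ℂ)))) := by
  rw [← integral_conj, ← integral_neg]
  congr 1 with t
  simp [← Complex.exp_conj]

/-- Weighted square-integrability on `(0, ∞)` of `ω ↦ ω H(ω)` against `1 / ρ`, for `H` bounded with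
all polynomial moments and `ρ` vanishing at most linearly at `0` and decaying at most
polynomially. -/
lemma integrableOn_sq_mul_div {ρ : ℝ → ℝ} (hcont : Continuous ρ)
    (hpos : ∀ ω : ℝ, 0 < ω → 0 < ρ ω) {c : ℝ} (hc : 0 < c)
    (hlin : ∀ ω ∈ Set.Icc (0 : ℝ) 1, c * ω ≤ ρ ω) {C : ℝ} (hC : 0 < C) {k : ℕ}
    (hlow : ∀ ω : ℝ, 1 ≤ ω → C / (1 + ω) ^ k ≤ ρ ω) {H : ℝ → ℂ} (hH : Continuous H)
    {M : ℝ} (hM : ∀ ω, ‖H ω‖ ≤ M) (hint : ∀ n : ℕ, Integrable fun ω => ‖ω‖ ^ n * ‖H ω‖) :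
    IntegrableOn (fun ω : ℝ => (ω * ‖H ω‖) ^ 2 / ρ ω) (Set.Ioi 0) := by
  have hM0 : 0 ≤ M := (norm_nonneg _).trans (hM 0)
  have hmeas : ∀ s ⊆ Set.Ioi (0 : ℝ), MeasurableSet s →
      AEStronglyMeasurable (fun ω : ℝ => (ω * ‖H ω‖) ^ 2 / ρ ω) (volume.restrict s) :=
    fun s hs hsm => ContinuousOn.aestronglyMeasurable
      (ContinuousOn.div (by fun_prop) hcont.continuousOn fun ω hω => (hpos ω (hs hω)).ne') hsm
  rw [← Set.Ioc_union_Ioi_eq_Ioi zero_le_one]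
  refine IntegrableOn.union ?_ ?_
  · refine Integrable.mono' (integrable_const (M ^ 2 / c))
      (hmeas _ Set.Ioc_subset_Ioi_self measurableSet_Ioc) ?_
    filter_upwards [ae_restrict_mem measurableSet_Ioc] with ω hω
    have hρ := hpos ω hω.1
    rw [Real.norm_of_nonneg (by positivity), div_le_div_iff₀ hρ hc]
    calc (ω * ‖H ω‖) ^ 2 * c = ω * ‖H ω‖ ^ 2 * (c * ω) := by ring
      _ ≤ 1 * M ^ 2 * ρ ω := by
        have := hω.1
        gcongr
        · exact hω.2
        · exact hM ω
        · exact hlin ω ⟨hω.1.le, hω.2⟩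
      _ = M ^ 2 * ρ ω := by ring
  · refine Integrable.mono' ((hint (k + 2)).integrableOn.const_mul (M * 2 ^ k / C))
      (hmeas _ (Set.Ioi_subset_Ioi zero_le_one) measurableSet_Ioi) ?_
    filter_upwards [ae_restrict_mem measurableSet_Ioi] with ω hω
    have hω1 : 1 < ω := hω
    have hω0 : 0 < ω := by linarith
    have hρ := hpos ω hω0
    rw [Real.norm_of_nonneg (by positivity), Real.norm_of_nonneg hω0.le]
    calc (ω * ‖H ω‖) ^ 2 / ρ ω ≤ (ω * ‖H ω‖) ^ 2 / (C / (2 * ω) ^ k) := by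
          gcongr
          refine le_trans ?_ (hlow ω hω1.le)
          gcongr
          linarith
      _ = ‖H ω‖ * (2 ^ k / C * (ω ^ (k + 2) * ‖H ω‖)) := by
          rw [mul_pow 2 ω k]
          field_simp
          ring
      _ ≤ M * (2 ^ k / C * (ω ^ (k + 2) * ‖H ω‖)) := by
          gcongr
          exact hM ω
      _ = _ := by ring

/-- If the spectral density `ρ` is continuous, odd, strictly positive on `(0,∞)`,
differentiable at `0` with nonzero derivative, and decays at most polynomially, then for
every `t₀` there is a nonzero smooth compactly supported `ψ` supported in `(−∞, t₀]`
whose Fourier transform `ψ̂(ω) = ∫ ψ(t) e^{−iωt} dt` satisfies the reality condition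
`ψ̂(−ω) = −conj(ψ̂(ω))` and the normalizability condition `∫₀^∞ |ψ̂(ω)|²/ρ(ω) dω < ∞`. -/
theorem full_support_spectral_density_half_line_commutant
    (ρ : ℝ → ℝ) (hcont : Continuous ρ)
    (hodd : ∀ ω : ℝ, ρ (-ω) = -ρ ω)
    (hpos : ∀ ω : ℝ, 0 < ω → 0 < ρ ω)
    (hderiv : ∃ d : ℝ, HasDerivAt ρ d 0 ∧ d ≠ 0)
    (C : ℝ) (hC : 0 < C) (k : ℕ)
    (hlow : ∀ ω : ℝ, 1 ≤ ω → C / (1 + ω) ^ k ≤ ρ ω) :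
    ∀ t₀ : ℝ, ∃ ψ : ℝ → ℂ,
      ContDiff ℝ (⊤ : ℕ∞) ψ ∧ HasCompactSupport ψ ∧ ψ ≠ 0 ∧
      tsupport ψ ⊆ Set.Iic t₀ ∧
      (∀ ω : ℝ, (∫ t : ℝ, ψ t * Complex.exp (-(Complex.I * ((-ω : ℝ) : ℂ) * (t : ℂ)))) =
        -(starRingEnd ℂ) (∫ t : ℝ, ψ t * Complex.exp (-(Complex.I * (ω : ℂ) * (t : ℂ))))) ∧
      IntegrableOn
        (fun ω : ℝ => ‖∫ t : ℝ, ψ t * Complex.exp (-(Complex.I * (ω : ℂ) * (t : ℂ)))‖ ^ 2 / ρ ω)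
        (Set.Ioi 0) := by
  intro t₀
  obtain ⟨d, hd, hd0⟩ := hderiv
  have h0 : ρ 0 = 0 := by
    have := hodd 0
    rw [neg_zero] at this
    linarith
  obtain ⟨c, hc, hlin⟩ := exists_mul_le_of_hasDerivAt_zero hcont h0 hpos hd hd0
  let φ : ContDiffBump (t₀ - 1) := ⟨1 / 2, 1, by norm_num, by norm_num⟩
  let Φ : ℝ → ℂ := fun t => Complex.I * (φ t : ℂ)
  have hφ : ContDiff ℝ (⊤ : ℕ∞) φ := φ.contDiff
  have hφd : Differentiable ℝ φ := hφ.differentiable (by simp)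
  have hΦ : ContDiff ℝ (⊤ : ℕ∞) Φ :=
    contDiff_const.mul (Complex.ofRealCLM.contDiff.comp hφ)
  have hderivΦ : deriv Φ = fun t => Complex.I * ((deriv φ t : ℝ) : ℂ) := by
    ext t
    exact ((hφd t).hasDerivAt.ofReal_comp.const_mul Complex.I).deriv
  have htsupp : tsupport Φ ⊆ tsupport φ :=
    closure_mono fun t ht h => ht (by simp [Φ, h])
  have hΦs : HasCompactSupport Φ := φ.hasCompactSupport.of_isClosed_subset isClosed_closure htsupp
  have hψ : ContDiff ℝ (⊤ : ℕ∞) (deriv Φ) := (contDiff_infty_iff_deriv.1 hΦ).2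
  let G := FourierTransform.fourier (hΦs.toSchwartzMap hΦ)
  have hG : ∀ ω, 𝓕 (deriv Φ) ω = 2 * Real.pi * Complex.I * ω * G ω := fun ω => by
    rw [Real.fourier_deriv (hΦ.continuous.integrable_of_hasCompactSupport hΦs)
      (hΦ.differentiable (by simp)) (hψ.continuous.integrable_of_hasCompactSupport hΦs.deriv)]
    rfl
  have hpi : (2 * Real.pi) ≠ 0 := by positivity
  refine ⟨deriv Φ, hψ, hΦs.deriv, fun h => ?_, ?_, fun ω => ?_, ?_⟩
  · have hconst := is_const_of_deriv_eq_zero (hΦ.differentiable (by simp)) (congrFun h)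
      (t₀ - 1) (t₀ + 1)
    have h1 : φ (t₀ - 1) = 1 := φ.one_of_mem_closedBall (by simp [φ])
    have h2 : φ (t₀ + 1) = 0 := φ.zero_of_le_dist (by
      rw [Real.dist_eq]; norm_num [φ])
    simp [Φ, h1, h2] at hconst
  · refine (closure_minimal (support_deriv_subset (f := Φ)) isClosed_closure).trans
      (htsupp.trans ?_)
    rw [φ.tsupport_eq, Real.closedBall_eq_Icc]
    intro t ht
    simpa [φ] using ht.2
  · rw [hderivΦ]
    exact integral_I_mul_ofReal_exp_neg _ ω
  · obtain ⟨M, -, hM⟩ := G.decay 0 0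
    have hint : ∀ n : ℕ, Integrable fun ω : ℝ => ‖ω‖ ^ n * ‖G (ω / (2 * Real.pi))‖ := fun n => by
      refine (((G.integrable_pow_mul volume n).comp_div hpi).const_mul
        (‖2 * Real.pi‖ ^ n)).congr (Filter.Eventually.of_forall fun ω => ?_)
      have := norm_ne_zero_iff.2 hpi
      simp only [norm_div, div_pow]
      field_simp
    refine (integrableOn_sq_mul_div hcont hpos hc hlin hC hlow
      (H := fun ω => G (ω / (2 * Real.pi))) (G.continuous.comp (by fun_prop))
      (fun ω => by simpa using hM (ω / (2 * Real.pi))) hint).congr_fun (fun ω _ => ?_)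
      measurableSet_Ioi
    dsimp only
    rw [integral_mul_exp_eq_fourier, hG]
    have h3 : 2 * (Real.pi : ℂ) * Complex.I * ((ω / (2 * Real.pi) : ℝ) : ℂ) = Complex.I * ω := by
      have : (Real.pi : ℂ) ≠ 0 := by exact_mod_cast Real.pi_ne_zero
      push_cast
      field_simp
    rw [h3]
    simp [mul_pow]
end

section
/- For every α ∈ (0, 1) and every δ > 0, there exist a smooth function φ : ℝ → ℂ, not identically zero, with support contained in [−δ, δ], and a constant C > 0, such that |φ̂(ω)| ≤ C exp(−|ω|^{1−α}) for all ω ∈ ℝ, where φ̂(ω) = ∫_ℝ φ(t) e^{−iωt} dt. -/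
open MeasureTheory

namespace Ingham

open Filter Topology Set

/-- Near `1`, the real part of `u ^ (-s)` stays above `1 / 2`. -/
theorem exists_half_le_re_inv_pow (s : ℕ) :
    ∃ η : ℝ, 0 < η ∧ η ≤ 1 ∧ ∀ u : ℂ, ‖u - 1‖ ≤ η → u ≠ 0 ∧ 1 / 2 ≤ ((u ^ s)⁻¹).re := by
  have h0 : ∀ᶠ u : ℂ in 𝓝 1, u ≠ 0 := eventually_ne_nhds one_ne_zero
  have hc : ContinuousAt (fun u : ℂ => ((u ^ s)⁻¹).re) 1 :=
    Complex.continuous_re.continuousAt.comp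
      (ContinuousAt.inv₀ (by fun_prop) (by simp))
  have h1 : ∀ᶠ u : ℂ in 𝓝 1, 1 / 2 < ((u ^ s)⁻¹).re :=
    hc.eventually (lt_mem_nhds (by norm_num))
  obtain ⟨ε, hε, h⟩ := Metric.eventually_nhds_iff.1 (h0.and h1)
  refine ⟨min 1 (ε / 2), by positivity, min_le_left _ _, fun u hu => ?_⟩
  have hu' : dist u 1 < ε := by
    rw [dist_eq_norm]
    linarith [min_le_right 1 (ε / 2)]
  exact ⟨(h hu').1, (h hu').2.le⟩

/-- If `f` agrees on an open set with a holomorphic function, so do the iterated derivatives. -/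
theorem iteratedDeriv_eq_of_eqOn_ofReal {f : ℝ → ℂ} {F : ℂ → ℂ} {U : Set ℝ} (hU : IsOpen U)
    (hF : ∀ t ∈ U, AnalyticAt ℂ F t) (hfF : ∀ t ∈ U, f t = F t) (n : ℕ) :
    ∀ t ∈ U, iteratedDeriv n f t = iteratedDeriv n F t := by
  induction n with
  | zero => simpa using hfF
  | succ n ih =>
    intro t ht
    have hd : HasDerivAt (iteratedDeriv n F) (iteratedDeriv (n + 1) F t) t := by
      rw [iteratedDeriv_succ, iteratedDeriv_eq_iterate]
      exact ((hF t ht).iterated_deriv n).differentiableAt.hasDerivAt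
    have he : iteratedDeriv n f =ᶠ[𝓝 t] fun y : ℝ => iteratedDeriv n F y := by
      filter_upwards [hU.mem_nhds ht] with y hy using ih y hy
    rw [iteratedDeriv_succ]
    exact (hd.comp_ofReal.congr_of_eventuallyEq he).deriv

/-- Repeated integration by parts for a smooth function supported in `[-1, 1]`. -/
theorem abs_pow_mul_norm_integral_le {f : ℝ → ℂ} (hf : ContDiff ℝ (⊤ : ℕ∞) f)
    (hs : tsupport f ⊆ Icc (-1) 1) {n : ℕ} {B : ℝ}
    (hB : ∀ t ∈ Ioo (-1 : ℝ) 1, ‖iteratedDeriv n f t‖ ≤ B) (ω : ℝ) :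
    |ω| ^ n * ‖∫ t : ℝ, f t * Complex.exp (-(Complex.I * (ω : ℂ) * (t : ℂ)))‖ ≤ 2 * B := by
  have hsupp (k : ℕ) : tsupport (iteratedDeriv k f) ⊆ Icc (-1) 1 := by
    induction k with
    | zero => simpa using hs
    | succ k ih =>
      rw [iteratedDeriv_succ]
      exact tsupport_deriv_subset.trans ih
  have hint (k : ℕ) (_ : (k : ℕ∞) ≤ ⊤) : Integrable (iteratedDeriv k f) :=
    (hf.continuous_iteratedDeriv k (by exact_mod_cast le_top)).integrable_of_hasCompactSupport
      (isCompact_Icc.of_isClosed_subset (isClosed_tsupport _) (hsupp k))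
  have h := congrFun (Real.fourier_iteratedDeriv hf hint (n := n) le_top) (ω / (2 * Real.pi))
  have hpi : (Real.pi : ℂ) ≠ 0 := by exact_mod_cast Real.pi_ne_zero
  have hω : 2 * (Real.pi : ℂ) * Complex.I * ((ω / (2 * Real.pi) : ℝ) : ℂ) = Complex.I * ω := by
    push_cast
    field_simp
  have hfou : FourierTransform.fourier f (ω / (2 * Real.pi)) =
      ∫ t : ℝ, f t * Complex.exp (-(Complex.I * (ω : ℂ) * (t : ℂ))) := by
    rw [Real.fourier_real_eq_integral_exp_smul]
    refine integral_congr_ae (.of_forall fun t => ?_)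
    simp only [smul_eq_mul]
    rw [mul_comm]
    congr 2
    push_cast
    field_simp
  rw [hω, hfou] at h
  have hnorm : |ω| ^ n * ‖∫ t : ℝ, f t * Complex.exp (-(Complex.I * (ω : ℂ) * (t : ℂ)))‖ =
      ‖FourierTransform.fourier (iteratedDeriv n f) (ω / (2 * Real.pi))‖ := by
    rw [h]
    simp
  rw [hnorm, Real.fourier_real_eq_integral_exp_smul]
  rw [← setIntegral_eq_integral_of_forall_compl_eq_zero (s := Icc (-1 : ℝ) 1),
    integral_Icc_eq_integral_Ioo]
  · refine (norm_setIntegral_le_of_norm_le_const (C := B) (by simp) fun t ht => ?_).trans ?_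
    · rw [norm_smul, Complex.norm_exp_ofReal_mul_I, one_mul]
      exact hB t ht
    · rw [Real.volume_real_Ioo_of_le (by norm_num)]
      linarith
  · intro t ht
    rw [image_eq_zero_of_notMem_tsupport (fun h => ht (hsupp n h)), smul_zero]

/-- The function `exp (-(1 - t²)⁻ˢ)` on `(-1, 1)`, extended by zero (for odd `s`). -/
noncomputable def bump (s : ℕ) (t : ℝ) : ℂ := (expNegInvGlue ((1 - t ^ 2) ^ s) : ℝ)

theorem contDiff_bump (s : ℕ) : ContDiff ℝ (⊤ : ℕ∞) (bump s) :=
  Complex.ofRealCLM.contDiff.comp (expNegInvGlue.contDiff.comp (by fun_prop))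

theorem bump_zero_ne_zero (s : ℕ) : bump s 0 ≠ 0 := by
  simp [bump]

theorem tsupport_bump_subset {s : ℕ} (hs : Odd s) : tsupport (bump s) ⊆ Icc (-1) 1 := by
  refine closure_minimal (fun t ht => ?_) isClosed_Icc
  by_contra h
  refine ht ?_
  have : 1 - t ^ 2 ≤ 0 := by
    by_contra! h1
    exact h (abs_le.1 (abs_le_one_iff_mul_self_le_one.2 (by nlinarith)))
  simp [bump, hs.pow_nonpos_iff.2 this]

theorem exists_norm_iteratedDeriv_bump_le (s : ℕ) :
    ∃ c : ℝ, 0 < c ∧ ∀ (n : ℕ), ∀ t ∈ Ioo (-1 : ℝ) 1, ‖iteratedDeriv n (bump s) t‖ ≤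
      n.factorial * Real.exp (-((1 - t ^ 2) ^ s)⁻¹ / 2) / (c * (1 - t ^ 2)) ^ n := by
  obtain ⟨η, hη, hη1, H⟩ := exists_half_le_re_inv_pow s
  set F : ℂ → ℂ := fun z => Complex.exp (-((1 - z ^ 2) ^ s)⁻¹) with hF
  have key : ∀ t ∈ Ioo (-1 : ℝ) 1, ∀ z : ℂ, ‖z - t‖ ≤ η / 3 * (1 - t ^ 2) →
      1 - z ^ 2 ≠ 0 ∧ ‖F z‖ ≤ Real.exp (-((1 - t ^ 2) ^ s)⁻¹ / 2) := by
    intro t ht z hz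
    have hd : 0 < 1 - t ^ 2 := by nlinarith [ht.1, ht.2]
    have htn : ‖(t : ℂ)‖ ≤ 1 := by
      rw [Complex.norm_real, Real.norm_eq_abs]
      exact abs_le.2 ⟨ht.1.le, ht.2.le⟩
    set d : ℝ := 1 - t ^ 2 with hdd
    have hd1 : d ≤ 1 := by nlinarith [sq_nonneg t]
    have hdc : (d : ℂ) ≠ 0 := by exact_mod_cast hd.ne'
    have hzt : ‖z + t‖ ≤ 3 := by
      have h1 : ‖z + t‖ ≤ ‖z - t‖ + ‖(t : ℂ)‖ + ‖(t : ℂ)‖ := by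
        calc ‖z + t‖ = ‖(z - t) + t + t‖ := by ring_nf
          _ ≤ _ := norm_add₃_le
      nlinarith
    obtain ⟨u, hu⟩ : ∃ u : ℂ, 1 - z ^ 2 = d * u := ⟨(1 - z ^ 2) / d, by field_simp⟩
    have hu1 : ‖u - 1‖ ≤ η := by
      have e : (d : ℂ) * (u - 1) = -((z - t) * (z + t)) := by
        rw [mul_sub, ← hu, hdd]
        push_cast
        ring
      have e' : d * ‖u - 1‖ = ‖z - t‖ * ‖z + t‖ := by
        have := congrArg norm e
        rwa [norm_mul, norm_neg, norm_mul, Complex.norm_real, Real.norm_of_nonneg hd.le] at this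
      have : d * ‖u - 1‖ ≤ d * η := by
        rw [e']
        calc ‖z - t‖ * ‖z + t‖ ≤ (η / 3 * d) * 3 := by gcongr
          _ = d * η := by ring
      exact le_of_mul_le_mul_left this hd
    obtain ⟨hu0, hre⟩ := H u hu1
    refine ⟨hu ▸ mul_ne_zero hdc hu0, ?_⟩
    rw [hF, Complex.norm_exp, Real.exp_le_exp, hu, mul_pow, mul_inv, Complex.neg_re,
      ← Complex.ofReal_pow, ← Complex.ofReal_inv, Complex.re_ofReal_mul]
    have : 0 < (d ^ s)⁻¹ := by positivity
    nlinarith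
  have han : ∀ z : ℂ, 1 - z ^ 2 ≠ 0 → AnalyticAt ℂ F z := fun z hz =>
    ((AnalyticAt.inv (f := fun z : ℂ => (1 - z ^ 2) ^ s) (by fun_prop) (pow_ne_zero _ hz)).neg).cexp
  refine ⟨η / 3, by positivity, fun n t ht => ?_⟩
  have hd : 0 < 1 - t ^ 2 := by nlinarith [ht.1, ht.2]
  rw [iteratedDeriv_eq_of_eqOn_ofReal (F := F) isOpen_Ioo ?_ ?_ n t ht]
  · refine Complex.norm_iteratedDeriv_le_of_forall_mem_sphere_norm_le n (by positivity) ?_ ?_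
    · refine DifferentiableOn.diffContOnCl fun z hz => ?_
      refine (han z (key t ht z ?_).1).differentiableAt.differentiableWithinAt
      simpa [dist_eq_norm] using Metric.closure_ball_subset_closedBall hz
    · intro z hz
      exact (key t ht z (mem_sphere_iff_norm.1 hz).le).2
  · intro x hx
    refine han _ (key x hx x ?_).1
    have : 0 < 1 - x ^ 2 := by nlinarith [hx.1, hx.2]
    simp only [sub_self, norm_zero]
    positivity
  · intro x hx
    have : 0 < 1 - x ^ 2 := by nlinarith [hx.1, hx.2]
    have h2 : ¬ (1 - x ^ 2) ^ s ≤ 0 := not_le.2 (by positivity)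
    simp only [bump, expNegInvGlue, if_neg h2, hF]
    push_cast
    rfl

theorem exists_norm_iteratedDeriv_mul_bump_le (s : ℕ) :
    ∃ K : ℝ, 0 < K ∧ ∀ m : ℕ, ∀ t ∈ Ioo (-1 : ℝ) 1, ‖iteratedDeriv (s * m) (bump s) t‖ ≤
      (K * (m : ℝ) ^ (s + 1)) ^ m := by
  obtain ⟨c, hc, H⟩ := exists_norm_iteratedDeriv_bump_le s
  refine ⟨2 * ((s : ℝ) + 1) ^ s / c ^ s, by positivity, fun m t ht => (H (s * m) t ht).trans ?_⟩
  have hd : 0 < 1 - t ^ 2 := by nlinarith [ht.1, ht.2]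
  set d : ℝ := 1 - t ^ 2
  have hx : 0 < (d ^ s)⁻¹ := by positivity
  have hd' : d ^ s = ((d ^ s)⁻¹)⁻¹ := (inv_inv _).symm
  rw [pow_mul, mul_pow c d, hd', inv_inv (d ^ s)⁻¹]
  set x : ℝ := (d ^ s)⁻¹
  have h1 : (x / 2) ^ m * Real.exp (-x / 2) ≤ m.factorial := by
    have h := Real.pow_div_factorial_le_exp (x / 2) (by positivity) m
    rw [div_le_iff₀ (by positivity)] at h
    calc (x / 2) ^ m * Real.exp (-x / 2)
        ≤ (Real.exp (x / 2) * m.factorial) * Real.exp (-x / 2) := by gcongr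
      _ = m.factorial * (Real.exp (x / 2) * Real.exp (-x / 2)) := by ring
      _ = m.factorial := by rw [← Real.exp_add, neg_div, add_neg_cancel, Real.exp_zero, mul_one]
  have hm : (m.factorial : ℝ) ≤ (m : ℝ) ^ m := by exact_mod_cast Nat.factorial_le_pow m
  have hsm : ((s * m).factorial : ℝ) ≤ (((s : ℝ) + 1) * m) ^ (s * m) := by
    calc ((s * m).factorial : ℝ) ≤ ((s * m : ℕ) : ℝ) ^ (s * m) := by
          exact_mod_cast Nat.factorial_le_pow _
      _ ≤ _ := by
        push_cast
        gcongr
        linarith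
  calc ((s * m).factorial : ℝ) * Real.exp (-x / 2) / (c ^ s * x⁻¹) ^ m
      = ((s * m).factorial : ℝ) * ((2 / c ^ s) ^ m * ((x / 2) ^ m * Real.exp (-x / 2))) := by
        simp only [mul_pow, div_pow, inv_pow]
        field_simp
    _ ≤ (((s : ℝ) + 1) * m) ^ (s * m) * ((2 / c ^ s) ^ m * (m : ℝ) ^ m) := by
        gcongr
        exact h1.trans hm
    _ = _ := by
        rw [pow_mul, ← mul_pow, ← mul_pow]
        congr 1
        rw [mul_pow]
        ring

/-- Optimising `m` in the bounds `(K m ^ (s + 1) / a ^ s) ^ m`. -/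
theorem exists_nat_optimal {K : ℝ} (hK : 0 < K) (s : ℕ) :
    ∃ κ : ℝ, 0 < κ ∧ ∀ a : ℝ, 0 < a → ∃ m : ℕ, (K * (m : ℝ) ^ (s + 1)) ^ m / a ^ (s * m) ≤
      Real.exp 1 * Real.exp (-(κ * a ^ ((s : ℝ) / (s + 1)))) := by
  set L : ℝ := K * Real.exp 1
  have hL : 0 < L := by positivity
  refine ⟨(L ^ (((s : ℝ) + 1)⁻¹))⁻¹, by positivity, fun a ha => ?_⟩
  set y : ℝ := (L ^ (((s : ℝ) + 1)⁻¹))⁻¹ * a ^ ((s : ℝ) / (s + 1))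
  have hy : 0 ≤ y := by positivity
  have hyp : L * y ^ (s + 1) = a ^ s := by
    have h1 : (L ^ (((s : ℝ) + 1)⁻¹)) ^ (s + 1) = L := by
      have := Real.rpow_inv_natCast_pow hL.le (Nat.succ_ne_zero s)
      push_cast at this
      exact this
    have h2 : (a ^ ((s : ℝ) / (s + 1))) ^ (s + 1) = a ^ s := by
      rw [← Real.rpow_natCast, ← Real.rpow_mul ha.le, ← Real.rpow_natCast a s]
      congr 1
      push_cast
      field_simp
    simp only [y]
    rw [mul_pow, inv_pow, h1, h2]
    field_simp
  refine ⟨⌊y⌋₊, ?_⟩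
  set m := ⌊y⌋₊
  have hmy : (m : ℝ) ≤ y := Nat.floor_le hy
  have hym : y < m + 1 := Nat.lt_floor_add_one y
  have hb : K * (m : ℝ) ^ (s + 1) / a ^ s ≤ Real.exp (-1) := by
    rw [div_le_iff₀ (by positivity), ← hyp, Real.exp_neg]
    calc K * (m : ℝ) ^ (s + 1) ≤ K * y ^ (s + 1) := by gcongr
      _ = _ := by
        simp only [L]
        field_simp
  rw [pow_mul, ← div_pow]
  calc (K * (m : ℝ) ^ (s + 1) / a ^ s) ^ m ≤ Real.exp (-1) ^ m := by gcongr
    _ = Real.exp (-m) := by rw [← Real.exp_nat_mul]; simp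
    _ ≤ Real.exp (1 + -y) := Real.exp_le_exp.2 (by linarith)
    _ = _ := Real.exp_add _ _

theorem exists_norm_integral_bump_le {s : ℕ} (hs : Odd s) :
    ∃ κ : ℝ, 0 < κ ∧ ∀ ω : ℝ, ω ≠ 0 →
      ‖∫ t : ℝ, bump s t * Complex.exp (-(Complex.I * (ω : ℂ) * (t : ℂ)))‖ ≤
        2 * Real.exp 1 * Real.exp (-(κ * |ω| ^ ((s : ℝ) / (s + 1)))) := by
  obtain ⟨K, hK, H⟩ := exists_norm_iteratedDeriv_mul_bump_le s
  obtain ⟨κ, hκ, H'⟩ := exists_nat_optimal hK s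
  refine ⟨κ, hκ, fun ω hω => ?_⟩
  have ha : 0 < |ω| := abs_pos.2 hω
  obtain ⟨m, hm⟩ := H' |ω| ha
  have h := abs_pow_mul_norm_integral_le (contDiff_bump s) (tsupport_bump_subset hs) (H m) ω
  rw [mul_comm, ← le_div_iff₀ (by positivity)] at h
  calc _ ≤ _ := h
    _ = 2 * ((K * (m : ℝ) ^ (s + 1)) ^ m / |ω| ^ (s * m)) := by ring
    _ ≤ 2 * (Real.exp 1 * Real.exp (-(κ * |ω| ^ ((s : ℝ) / (s + 1))))) := by gcongr
    _ = _ := by ring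

/-- A larger power with any positive coefficient dominates a smaller power up to a constant. -/
theorem exists_rpow_le_mul_rpow_add {p q κ : ℝ} (hp : 0 ≤ p) (hpq : p < q) (hκ : 0 < κ) :
    ∃ M : ℝ, ∀ a : ℝ, 0 < a → a ^ p ≤ κ * a ^ q + M := by
  refine ⟨(κ⁻¹ ^ (q - p)⁻¹) ^ p, fun a ha => ?_⟩
  have hqp : 0 < q - p := sub_pos.2 hpq
  rcases le_total a (κ⁻¹ ^ (q - p)⁻¹) with h | h
  · have h1 : a ^ p ≤ (κ⁻¹ ^ (q - p)⁻¹) ^ p := Real.rpow_le_rpow ha.le h hp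
    have h2 : 0 ≤ κ * a ^ q := by positivity
    linarith
  · have h1 : κ⁻¹ ≤ a ^ (q - p) := by
      have := Real.rpow_le_rpow (by positivity) h hqp.le
      rwa [← Real.rpow_mul (by positivity), inv_mul_cancel₀ hqp.ne', Real.rpow_one] at this
    have h2 : a ^ p ≤ κ * a ^ q := by
      calc a ^ p = κ * (κ⁻¹ * a ^ p) := by field_simp
        _ ≤ κ * (a ^ (q - p) * a ^ p) := by gcongr
        _ = κ * a ^ q := by rw [← Real.rpow_add ha, sub_add_cancel]
    have h3 : 0 ≤ (κ⁻¹ ^ (q - p)⁻¹) ^ p := by positivity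
    linarith

/-- Scaling behaviour of the Fourier integral. -/
theorem integral_comp_div_mul_exp (f : ℝ → ℂ) {δ : ℝ} (hδ : 0 < δ) (ω : ℝ) :
    ∫ t : ℝ, f (t / δ) * Complex.exp (-(Complex.I * (ω : ℂ) * (t : ℂ))) =
      δ * ∫ t : ℝ, f t * Complex.exp (-(Complex.I * ((δ * ω : ℝ) : ℂ) * (t : ℂ))) := by
  have h := Measure.integral_comp_div
    (fun t : ℝ => f t * Complex.exp (-(Complex.I * ((δ * ω : ℝ) : ℂ) * (t : ℂ)))) δ
  rw [abs_of_pos hδ, Complex.real_smul] at h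
  rw [← h]
  have hδ' : (δ : ℂ) ≠ 0 := by exact_mod_cast hδ.ne'
  refine integral_congr_ae (.of_forall fun t => ?_)
  simp only
  congr 3
  push_cast
  field_simp

end Ingham

open Ingham in
/-- Ingham's theorem: for every `α ∈ (0,1)` and `δ > 0` there is a nonzero smooth function
supported in `[−δ, δ]` whose Fourier transform `φ̂(ω) = ∫ φ(t) e^{−iωt} dt` decays like
`exp(−|ω|^{1−α})`. -/
theorem ingham_test_function (α : ℝ) (hα : α ∈ Set.Ioo (0 : ℝ) 1) (δ : ℝ) (hδ : 0 < δ) :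
    ∃ φ : ℝ → ℂ, ContDiff ℝ (⊤ : ℕ∞) φ ∧ φ ≠ 0 ∧ tsupport φ ⊆ Set.Icc (-δ) δ ∧
      ∃ C : ℝ, 0 < C ∧ ∀ ω : ℝ,
        ‖∫ t : ℝ, φ t * Complex.exp (-(Complex.I * (ω : ℂ) * (t : ℂ)))‖ ≤
          C * Real.exp (-(|ω| ^ (1 - α))) := by
  obtain ⟨hα0, hα1⟩ := hα
  obtain ⟨k, hk⟩ := exists_nat_gt (1 / α)
  set s : ℕ := 2 * k + 1 with hsdef
  have hs : Odd s := odd_two_mul_add_one k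
  have hpq : 1 - α < (s : ℝ) / (s + 1) := by
    rw [div_lt_iff₀ hα0] at hk
    rw [lt_div_iff₀ (by positivity), hsdef]
    push_cast
    nlinarith
  obtain ⟨κ, hκ, H⟩ := exists_norm_integral_bump_le hs
  set q : ℝ := (s : ℝ) / (s + 1)
  obtain ⟨M, hM⟩ := exists_rpow_le_mul_rpow_add (sub_nonneg.2 hα1.le) hpq
    (show 0 < κ * δ ^ q by positivity)
  refine ⟨fun t => bump s (t / δ), (contDiff_bump s).comp (contDiff_id.div_const δ), fun h => ?_,
    closure_minimal (fun t ht => ?_) isClosed_Icc,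
    δ * (2 * Real.exp 1) * Real.exp M +
      ‖∫ t : ℝ, bump s (t / δ) * Complex.exp (-(Complex.I * ((0 : ℝ) : ℂ) * (t : ℂ)))‖,
    by positivity, fun ω => ?_⟩
  · exact bump_zero_ne_zero s (by simpa using congrFun h 0)
  · have h := tsupport_bump_subset hs (subset_tsupport _ ht)
    rw [Set.mem_Icc, le_div_iff₀ hδ, div_le_iff₀ hδ] at h
    exact ⟨by linarith [h.1], by linarith [h.2]⟩
  · rcases eq_or_ne ω 0 with rfl | hω
    · rw [abs_zero, Real.zero_rpow (sub_pos.2 hα1).ne', neg_zero, Real.exp_zero, mul_one]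
      exact le_add_of_nonneg_left (by positivity)
    · have h1 := H (δ * ω) (mul_ne_zero hδ.ne' hω)
      rw [abs_mul, abs_of_pos hδ, Real.mul_rpow hδ.le (abs_nonneg ω), ← mul_assoc κ] at h1
      rw [integral_comp_div_mul_exp _ hδ, norm_mul, Complex.norm_real, Real.norm_of_nonneg hδ.le]
      have h2 := hM |ω| (abs_pos.2 hω)
      calc _ ≤ δ * (2 * Real.exp 1 * Real.exp (-(κ * δ ^ q * |ω| ^ q))) := by gcongr
        _ ≤ δ * (2 * Real.exp 1 * Real.exp (M + -(|ω| ^ (1 - α)))) := by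
          gcongr
          linarith
        _ = δ * (2 * Real.exp 1) * Real.exp M * Real.exp (-(|ω| ^ (1 - α))) := by
          rw [Real.exp_add]
          ring
        _ ≤ _ := by
          gcongr
          exact le_add_of_nonneg_right (norm_nonneg _)
end

section
/- For every d > 0 there exists N ∈ ℕ such that for every natural number n ≥ N, the number of prime numbers p satisfying n(n+1)/2 ≤ log p ≤ (n+1)(n+2)/2 is at least d·(n+1), where log denotes the natural logarithm. -/
open Filter in
/-- A constant multiple of `t ^ k` is eventually dominated by `exp t`. -/
theorem eventually_mul_pow_le_exp (c : ℝ) (k : ℕ) :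
    ∀ᶠ t : ℝ in atTop, c * t ^ k ≤ Real.exp t := by
  have h := (Real.isLittleO_pow_exp_atTop (n := k)).const_mul_left c
  filter_upwards [h.bound one_pos] with t ht
  rw [one_mul, Real.norm_of_nonneg (Real.exp_pos t).le] at ht
  exact (le_abs_self _).trans ht

open Filter in
/-- A Chebyshev lower bound: `θ(x) ≥ x / 2` for all large `x = exp t`. -/
theorem eventually_half_exp_le_theta_exp :
    ∀ᶠ t : ℝ in atTop, Real.exp t / 2 ≤ Chebyshev.theta (Real.exp t) := by
  have h_half : Tendsto (fun t : ℝ => t / 2) atTop atTop :=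
    tendsto_id.atTop_div_const two_pos
  filter_upwards [h_half.eventually (eventually_mul_pow_le_exp 200 1), eventually_ge_atTop 3]
    with t ht ht3
  have hsq : Real.exp t = Real.exp (t / 2) ^ 2 := by
    rw [← Real.exp_nat_mul]; congr 1; push_cast; ring
  have h1 : 1 ≤ Real.exp t := Real.one_le_exp (by linarith)
  have hθ := Chebyshev.theta_ge' h1
  have hlog : Real.log (Real.exp t + 2) ≤ t + 2 := by
    calc Real.log (Real.exp t + 2) ≤ Real.log (3 * Real.exp t) :=
          Real.log_le_log (by positivity) (by linarith)
      _ = Real.log 3 + t := by rw [Real.log_mul (by norm_num) (by positivity), Real.log_exp]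
      _ ≤ t + 2 := by linarith [Real.log_le_sub_one_of_pos (show (0 : ℝ) < 3 by norm_num)]
  rw [Real.log_exp, show √(Real.exp t) = Real.exp (t / 2) by
    rw [hsq, Real.sqrt_sq (Real.exp_pos _).le]] at hθ
  have hl := Real.log_two_gt_d9
  have h2 : (Real.exp t - 1) * 0.69 ≤ (Real.exp t - 1) * Real.log 2 := by
    gcongr
    linarith
  have hu : 100 * t ≤ Real.exp (t / 2) := by linarith
  have h3 : 100 * t * Real.exp (t / 2) ≤ Real.exp t := by
    rw [hsq, sq]; gcongr
  have h4 : 300 * t ≤ 100 * t * Real.exp (t / 2) := by nlinarith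
  nlinarith

open Chebyshev in
/-- Every prime in `(x, y]` contributes at most `log y` to `θ(y) - θ(x)`. -/
theorem theta_sub_theta_le_ncard_mul_log {x y : ℝ} (hx : 0 ≤ x) (hxy : x ≤ y)
    (hy : 1 ≤ y) (S : Set ℕ)
    (hS : ∀ p : ℕ, p.Prime → x < p → (p : ℝ) ≤ y → p ∈ S) (hfin : S.Finite) :
    theta y - theta x ≤ S.ncard * Real.log y := by
  have hsub : Nat.primesLE ⌊x⌋₊ ⊆ Nat.primesLE ⌊y⌋₊ := fun p hp => by
    rw [Nat.mem_primesLE] at hp ⊢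
    exact ⟨hp.1.trans (Nat.floor_mono hxy), hp.2⟩
  rw [theta_eq_sum_primesLE, theta_eq_sum_primesLE, ← Finset.sum_sdiff hsub, add_sub_cancel_right]
  have hmem : ∀ p ∈ Nat.primesLE ⌊y⌋₊ \ Nat.primesLE ⌊x⌋₊,
      p.Prime ∧ x < p ∧ (p : ℝ) ≤ y := fun p hp => by
    rw [Finset.mem_sdiff, Nat.mem_primesLE, Nat.mem_primesLE] at hp
    obtain ⟨⟨hpy, hp⟩, hpx⟩ := hp
    exact ⟨hp, (Nat.floor_lt hx).1 (not_le.1 fun h => hpx ⟨h, hp⟩),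
      (Nat.le_floor_iff (hx.trans hxy)).1 hpy⟩
  calc ∑ p ∈ Nat.primesLE ⌊y⌋₊ \ Nat.primesLE ⌊x⌋₊, Real.log p
      ≤ ∑ _p ∈ Nat.primesLE ⌊y⌋₊ \ Nat.primesLE ⌊x⌋₊, Real.log y :=
        Finset.sum_le_sum fun p hp => Real.log_le_log
          (by exact_mod_cast (hmem p hp).1.pos) (hmem p hp).2.2
    _ = (Nat.primesLE ⌊y⌋₊ \ Nat.primesLE ⌊x⌋₊).card * Real.log y := by
        rw [Finset.sum_const, nsmul_eq_mul]
    _ ≤ S.ncard * Real.log y := by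
        have hlogy := Real.log_nonneg hy
        gcongr
        rw [← Set.ncard_coe_finset]
        exact Set.ncard_le_ncard
          (fun p hp => hS p (hmem p hp).1 (hmem p hp).2.1 (hmem p hp).2.2) hfin

/-- For every `d > 0`, for all large enough `n`, the number of primes `p` with
`n(n+1)/2 ≤ log p ≤ (n+1)(n+2)/2` is at least `d·(n+1)`. -/
theorem primes_in_log_interval (d : ℝ) (hd : 0 < d) :
    ∃ N : ℕ, ∀ n : ℕ, N ≤ n →
      d * ((n : ℝ) + 1) ≤
        (({p : ℕ | p.Prime ∧ (n : ℝ) * ((n : ℝ) + 1) / 2 ≤ Real.log p ∧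
            Real.log p ≤ ((n : ℝ) + 1) * ((n : ℝ) + 2) / 2}).ncard : ℝ) := by
  have h_large := (eventually_half_exp_le_theta_exp.and
    ((eventually_mul_pow_le_exp (8 * d) 2).and (Filter.eventually_ge_atTop 3)))
  obtain ⟨T, hT⟩ := Filter.eventually_atTop.1 h_large
  refine ⟨max 2 ⌈T⌉₊, fun n hn => ?_⟩
  have hn2 : (2 : ℝ) ≤ n := by exact_mod_cast (le_max_left _ _).trans hn
  have hnT : T ≤ n := Nat.ceil_le.1 ((le_max_right _ _).trans hn)
  set a : ℝ := (n : ℝ) * ((n : ℝ) + 1) / 2 with ha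
  set b : ℝ := ((n : ℝ) + 1) * ((n : ℝ) + 2) / 2 with hb
  have hab : b = a + (n + 1) := by rw [ha, hb]; ring
  have ha0 : 0 ≤ a := by positivity
  obtain ⟨hθb, hdb, hb3⟩ := hT b (by linarith)
  set S : Set ℕ := {p : ℕ | p.Prime ∧ a ≤ Real.log p ∧ Real.log p ≤ b}
  have hfin : S.Finite := by
    refine (Set.finite_Iic ⌊Real.exp b⌋₊).subset fun p hp => Nat.le_floor ?_
    exact (Real.log_le_iff_le_exp (by exact_mod_cast hp.1.pos)).1 hp.2.2
  have hcount := theta_sub_theta_le_ncard_mul_log (x := Real.exp a) (y := Real.exp b)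
    (Real.exp_pos a).le (Real.exp_le_exp.2 (by linarith)) (Real.one_le_exp (by linarith)) S
    (fun p hp hpa hpb =>
      have hp0 : (0 : ℝ) < p := by exact_mod_cast hp.pos
      ⟨hp, (Real.le_log_iff_exp_le hp0).2 hpa.le, (Real.log_le_iff_le_exp hp0).2 hpb⟩) hfin
  rw [Real.log_exp] at hcount
  have hθa : Chebyshev.theta (Real.exp a) ≤ 2 * Real.exp a := by
    refine (Chebyshev.theta_le_log4_mul_x (Real.exp_pos a).le).trans ?_
    gcongr
    rw [show (4 : ℝ) = 2 ^ 2 by norm_num, Real.log_pow]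
    push_cast
    linarith [Real.log_two_lt_d9]
  have hexp : 8 * Real.exp a ≤ Real.exp b := by
    rw [hab, Real.exp_add, mul_comm]
    gcongr
    calc (8 : ℝ) = 2 ^ 3 := by norm_num
      _ ≤ Real.exp 1 ^ 3 := by gcongr; linarith [Real.exp_one_gt_d9]
      _ = Real.exp 3 := by rw [← Real.exp_nat_mul]; norm_num
      _ ≤ Real.exp (n + 1) := Real.exp_le_exp.2 (by linarith)
  have hb0 : 0 < b := by linarith
  refine le_of_mul_le_mul_right ?_ hb0
  calc d * ((n : ℝ) + 1) * b ≤ d * b * b := by gcongr; linarith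
    _ ≤ S.ncard * b := by nlinarith
end
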